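/- Let n, m ≥ 1, α ∈ (0,1), β ≥ 0. Let 0 < p < ∞, r₀, s₀ ∈ (0, ∞], θ₀ ∈ (0,1], and let q be defined by 1/r₀ = θ₀/q + (1−θ₀)/s₀; assume p ≤ q < ∞. Suppose there is a constant C > 0 such that for every f ∈ C_c^∞(ℝ^{n+m}), sup_{λ>0} λ |{ξ : |f(ξ)| ≥ λ}|^{1/r₀} ≤ C ‖∇_L f‖_{L^p}^{θ₀} ‖f‖_{L^∞}^{1−θ₀} |supp(f)|^{(1−θ₀)/s₀}. Then there is a constant C' > 0 such that ‖f‖_{L^q} ≤ C' ‖∇_L f‖_{L^p} for all f ∈ C_c^∞(ℝ^{n+m}), where q = r₀ s₀ θ₀ / (s₀ − r₀(1−θ₀)). -/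

import Mathlib

open MeasureTheory

/-- The pointwise norm of the Grushin gradient
`∇_L f = (|x|^α ∇_x f, |x|^β ∇_y f)` of `f : ℝⁿ × ℝᵐ → ℝ`,
i.e. `|∇_L f(x,y)|² = |x|^{2α} |∇_x f|² + |x|^{2β} |∇_y f|²`. -/
noncomputable def gradLNorm (n m : ℕ) (α β : ℝ)
    (f : EuclideanSpace ℝ (Fin n) × EuclideanSpace ℝ (Fin m) → ℝ)
    (ξ : EuclideanSpace ℝ (Fin n) × EuclideanSpace ℝ (Fin m)) : ℝ :=
  Real.sqrt (‖ξ.1‖ ^ (2 * α) * ‖gradient (fun x => f (x, ξ.2)) ξ.1‖ ^ 2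
    + ‖ξ.1‖ ^ (2 * β) * ‖gradient (fun y => f (ξ.1, y)) ξ.2‖ ^ 2)

/-- The homogeneous dimension `Q = (n + m(β+1−α))/(1−α)`. -/
noncomputable def homDim (n m : ℕ) (α β : ℝ) : ℝ :=
  (n + m * (β + 1 - α)) / (1 - α)

open scoped ENNReal

/-- A smooth even profile that vanishes on `[-1, 1]`, equals `1` outside `(-2, 2)`, and whose
derivative is bounded and supported in `1 < |t| ≤ 2`. -/
lemma exists_smooth_truncation_profile : ∃ (ψ : ℝ → ℝ) (M : ℝ), ContDiff ℝ (⊤ : ℕ∞) ψ ∧ 0 < M ∧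
    (∀ t, |t| ≤ 1 → ψ t = 0) ∧ (∀ t, 2 ≤ |t| → ψ t = 1) ∧ (∀ t, |ψ t| ≤ 1) ∧
    (∀ t, |deriv ψ t| ≤ M) ∧ (∀ t, ¬ (1 < |t| ∧ |t| ≤ 2) → deriv ψ t = 0) := by
  set ψ : ℝ → ℝ := fun t => Real.smoothTransition ((t ^ 2 - 1) / 3) with hψ
  have hsm : ContDiff ℝ (⊤ : ℕ∞) ψ :=
    Real.smoothTransition.contDiff.comp (((contDiff_id.pow 2).sub contDiff_const).div_const 3)
  have h0 : ∀ t, |t| ≤ 1 → ψ t = 0 := fun t ht => by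
    have := (sq_le_one_iff_abs_le_one t).2 ht
    exact Real.smoothTransition.zero_of_nonpos (by linarith)
  have h1 : ∀ t, 2 ≤ |t| → ψ t = 1 := fun t ht => by
    have : 4 ≤ t ^ 2 := by rw [← sq_abs]; nlinarith
    exact Real.smoothTransition.one_of_one_le (by linarith)
  have hz : ∀ t, ¬ (1 < |t| ∧ |t| ≤ 2) → deriv ψ t = 0 := by
    intro t ht
    rcases le_or_gt |t| 1 with h | h
    · refine IsLocalMin.deriv_eq_zero (Filter.Eventually.of_forall fun s => ?_)
      rw [h0 t h]
      exact Real.smoothTransition.nonneg _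
    · refine IsLocalMax.deriv_eq_zero (Filter.Eventually.of_forall fun s => ?_)
      rw [h1 t (not_le.1 fun h' => ht ⟨h, h'⟩).le]
      exact Real.smoothTransition.le_one _
  have hc : Continuous (deriv ψ) := hsm.continuous_deriv (by simp)
  obtain ⟨M, hM⟩ := (isCompact_Icc (a := (-2 : ℝ)) (b := 2)).exists_bound_of_continuousOn
    hc.continuousOn
  refine ⟨ψ, max M 1, hsm, by positivity, h0, h1, fun t => ?_, fun t => ?_, hz⟩
  · rw [abs_of_nonneg (Real.smoothTransition.nonneg _)]
    exact Real.smoothTransition.le_one _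
  · by_cases ht : |t| ≤ 2
    · exact (hM t (abs_le.1 ht)).trans (le_max_left _ _)
    · rw [hz t fun h => ht h.2, abs_zero]
      positivity

lemma norm_gradient_eq_norm_fderiv {F : Type*} [NormedAddCommGroup F] [InnerProductSpace ℝ F]
    [CompleteSpace F] (f : F → ℝ) (x : F) : ‖gradient f x‖ = ‖fderiv ℝ f x‖ := by
  simp [gradient]

lemma gradLNorm_nonneg (n m : ℕ) (α β : ℝ)
    (f : EuclideanSpace ℝ (Fin n) × EuclideanSpace ℝ (Fin m) → ℝ)
    (ξ : EuclideanSpace ℝ (Fin n) × EuclideanSpace ℝ (Fin m)) : 0 ≤ gradLNorm n m α β f ξ :=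
  Real.sqrt_nonneg _

lemma gradLNorm_comp {n m : ℕ} (α β : ℝ) {φ : ℝ → ℝ}
    {f : EuclideanSpace ℝ (Fin n) × EuclideanSpace ℝ (Fin m) → ℝ}
    (hφ : Differentiable ℝ φ) (hf : Differentiable ℝ f)
    (ξ : EuclideanSpace ℝ (Fin n) × EuclideanSpace ℝ (Fin m)) :
    gradLNorm n m α β (fun η => φ (f η)) ξ = |deriv φ (f ξ)| * gradLNorm n m α β f ξ := by
  have key : ∀ {F : Type} [NormedAddCommGroup F] [InnerProductSpace ℝ F] [CompleteSpace F]
      (g : F → ℝ), Differentiable ℝ g → ∀ x,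
      ‖gradient (fun y => φ (g y)) x‖ = |deriv φ (g x)| * ‖gradient g x‖ := by
    intro F _ _ _ g hg x
    have hd : fderiv ℝ (fun y => φ (g y)) x = deriv φ (g x) • fderiv ℝ g x :=
      ((hφ (g x)).hasDerivAt.comp_hasFDerivAt x (hg x).hasFDerivAt).fderiv
    rw [norm_gradient_eq_norm_fderiv, norm_gradient_eq_norm_fderiv, hd, norm_smul,
      Real.norm_eq_abs]
  unfold gradLNorm
  rw [key (fun x => f (x, ξ.2)) (by fun_prop), key (fun y => f (ξ.1, y)) (by fun_prop),
    ← Real.sqrt_sq (abs_nonneg (deriv φ (f ξ))), ← Real.sqrt_mul (sq_nonneg _)]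
  simp only [Real.sqrt_sq (abs_nonneg (deriv φ (f ξ)))]
  congr 1
  ring

lemma gradLNorm_eq {n m : ℕ} (α β : ℝ)
    {f : EuclideanSpace ℝ (Fin n) × EuclideanSpace ℝ (Fin m) → ℝ} (hf : Differentiable ℝ f)
    (ξ : EuclideanSpace ℝ (Fin n) × EuclideanSpace ℝ (Fin m)) :
    gradLNorm n m α β f ξ = Real.sqrt
      (‖ξ.1‖ ^ (2 * α) * ‖(fderiv ℝ f ξ).comp (ContinuousLinearMap.inl ℝ _ _)‖ ^ 2
        + ‖ξ.1‖ ^ (2 * β) * ‖(fderiv ℝ f ξ).comp (ContinuousLinearMap.inr ℝ _ _)‖ ^ 2) := by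
  have h1 : fderiv ℝ (fun x => f (x, ξ.2)) ξ.1
      = (fderiv ℝ f ξ).comp (ContinuousLinearMap.inl ℝ _ _) :=
    ((hf ξ).hasFDerivAt.comp ξ.1 (hasFDerivAt_prodMk_left ξ.1 ξ.2)).fderiv
  have h2 : fderiv ℝ (fun y => f (ξ.1, y)) ξ.2
      = (fderiv ℝ f ξ).comp (ContinuousLinearMap.inr ℝ _ _) :=
    ((hf ξ).hasFDerivAt.comp ξ.2 (hasFDerivAt_prodMk_right ξ.1 ξ.2)).fderiv
  rw [gradLNorm, norm_gradient_eq_norm_fderiv, norm_gradient_eq_norm_fderiv, h1, h2]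

lemma continuous_gradLNorm {n m : ℕ} {α β : ℝ} (hα : 0 ≤ α) (hβ : 0 ≤ β)
    {f : EuclideanSpace ℝ (Fin n) × EuclideanSpace ℝ (Fin m) → ℝ} (hf : ContDiff ℝ (⊤ : ℕ∞) f) :
    Continuous (gradLNorm n m α β f) := by
  have hc : Continuous (fderiv ℝ f) := hf.continuous_fderiv (by simp)
  rw [show gradLNorm n m α β f = _ from funext (gradLNorm_eq α β (hf.differentiable (by simp)))]
  have hp : ∀ c : ℝ, 0 ≤ c → Continuous
      fun ξ : EuclideanSpace ℝ (Fin n) × EuclideanSpace ℝ (Fin m) => ‖ξ.1‖ ^ (2 * c) :=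
    fun c hc => continuous_fst.norm.rpow_const fun _ => Or.inr (by positivity)
  exact (((hp α hα).mul ((hc.clm_comp continuous_const).norm.pow 2)).add
    ((hp β hβ).mul ((hc.clm_comp continuous_const).norm.pow 2))).sqrt

lemma integrable_gradLNorm_rpow {n m : ℕ} {α β p : ℝ} (hα : 0 ≤ α) (hβ : 0 ≤ β) (hp : 0 < p)
    {f : EuclideanSpace ℝ (Fin n) × EuclideanSpace ℝ (Fin m) → ℝ}
    (hf : ContDiff ℝ (⊤ : ℕ∞) f) (hfc : HasCompactSupport f) :
    Integrable fun ξ => gradLNorm n m α β f ξ ^ p := by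
  refine ((continuous_gradLNorm hα hβ hf).rpow_const fun _ => Or.inr hp.le)
    |>.integrable_of_hasCompactSupport ((hfc.fderiv (𝕜 := ℝ)).mono fun ξ hξ h0 => hξ ?_)
  simp [gradLNorm_eq α β (hf.differentiable (by simp)), h0, hp.ne']

/-- Young's inequality absorbing half of `a` from a multiplicative bound on `b`. -/
lemma le_half_add_of_rpow_le {q r θ σ K a b G : ℝ} (hq : 0 < q) (hr : 0 < r) (hθ : 0 < θ)
    (hσ : 0 ≤ σ) (hrel : 1 / r = θ / q + σ) (hK : 0 < K) (ha : 0 ≤ a) (hb : 0 ≤ b) (hG : 0 ≤ G)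
    (h : b ^ (1 / r) ≤ K * G ^ θ * a ^ σ) :
    b ≤ a / 2 + (K ^ r * 2 ^ (σ * r)) ^ (q / (θ * r)) * G ^ q := by
  have hsum : θ * r / q + σ * r = 1 := by
    field_simp at hrel ⊢
    linarith
  set τ := σ * r with hτ
  set w := θ * r / q with hw
  have hw0 : 0 < w := by positivity
  have hτ0 : 0 ≤ τ := by positivity
  set D := (K ^ r * 2 ^ τ) ^ (q / (θ * r)) with hD
  have hD0 : 0 < D := by positivity
  have hDw : D ^ w = K ^ r * 2 ^ τ := by
    rw [hD, ← Real.rpow_mul (by positivity), hw, show q / (θ * r) * (θ * r / q) = 1 by field_simp,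
      Real.rpow_one]
  have h1 : b ≤ (D * G ^ q) ^ w * (a / 2) ^ τ := by
    calc b = (b ^ (1 / r)) ^ r := by rw [← Real.rpow_mul hb]; field_simp; simp
      _ ≤ (K * G ^ θ * a ^ σ) ^ r := Real.rpow_le_rpow (by positivity) h hr.le
      _ = K ^ r * G ^ (θ * r) * a ^ τ := by
        rw [Real.mul_rpow (by positivity) (by positivity), Real.mul_rpow hK.le (by positivity),
          ← Real.rpow_mul hG, ← Real.rpow_mul ha]
      _ = (D * G ^ q) ^ w * (a / 2) ^ τ := by
        rw [Real.mul_rpow hD0.le (by positivity), hDw, Real.div_rpow ha (by norm_num),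
          ← Real.rpow_mul hG, hw, show q * (θ * r / q) = θ * r by field_simp]
        have : (2 : ℝ) ^ τ ≠ 0 := by positivity
        field_simp
  have h2 := Real.geom_mean_le_arith_mean2_weighted hw0.le hτ0
    (show 0 ≤ D * G ^ q by positivity) (show 0 ≤ a / 2 by positivity) hsum
  have h3 : w * (D * G ^ q) ≤ D * G ^ q := mul_le_of_le_one_left (by positivity) (by linarith)
  have h4 : τ * (a / 2) ≤ a / 2 := mul_le_of_le_one_left (by positivity) (by linarith)
  linarith

/-- Summing the recursive estimate `a (k + 1) ≤ a k / 2 + D * g k ^ t` over all integers. -/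
lemma tsum_le_of_forall_le_half_add {a g : ℤ → ℝ} {D t G : ℝ} (ha : Summable a) (hg : HasSum g G)
    (hg0 : ∀ k, 0 ≤ g k) (ht : 1 ≤ t) (hD : 0 ≤ D)
    (h : ∀ k, a (k + 1) ≤ a k / 2 + D * g k ^ t) : ∑' k, a k ≤ 2 * D * G ^ t := by
  have hG : 0 ≤ G := hg.nonneg hg0
  have hle : ∀ k, g k ^ t ≤ g k * G ^ (t - 1) := fun k => by
    calc g k ^ t = g k ^ (1 + (t - 1)) := by ring_nf
      _ = g k * g k ^ (t - 1) := by
        rw [Real.rpow_add_of_nonneg (hg0 k) zero_le_one (by linarith), Real.rpow_one]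
      _ ≤ g k * G ^ (t - 1) := by
        have := le_hasSum hg k fun j _ => hg0 j
        gcongr <;> exact hg0 k
  have hs := hg.mul_right (G ^ (t - 1))
  have hst : Summable fun k => g k ^ t :=
    Summable.of_nonneg_of_le (fun k => Real.rpow_nonneg (hg0 k) t) hle hs.summable
  have h1 : ∑' k, g k ^ t ≤ G ^ t := by
    calc ∑' k, g k ^ t ≤ G * G ^ (t - 1) := hs.tsum_eq ▸ hst.tsum_le_tsum hle hs.summable
      _ = G ^ (1 + (t - 1)) := by
        rw [Real.rpow_add_of_nonneg hG zero_le_one (by linarith), Real.rpow_one]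
      _ = G ^ t := by ring_nf
  have hshift : Summable fun k => a (k + 1) := (Equiv.addRight (1 : ℤ)).summable_iff.2 ha
  have h2 : ∑' k, a (k + 1) = ∑' k, a k := (Equiv.addRight (1 : ℤ)).tsum_eq a
  have h3 : ∑' k, a (k + 1) ≤ (∑' k, a k) / 2 + D * ∑' k, g k ^ t := by
    rw [← tsum_div_const, ← tsum_mul_left, ← (ha.div_const 2).tsum_add (hst.mul_left D)]
    exact hshift.tsum_le_tsum h ((ha.div_const 2).add (hst.mul_left D))
  nlinarith [mul_le_mul_of_nonneg_left h1 hD]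

/-- The dyadic shell `{2 ^ k < |f| ≤ 2 ^ (k + 1)}`. -/
def dyadicShell {X : Type*} (f : X → ℝ) (k : ℤ) : Set X :=
  {x | (2 : ℝ) ^ k < |f x| ∧ |f x| ≤ 2 ^ (k + 1)}

lemma iUnion_dyadicShell {X : Type*} (f : X → ℝ) :
    ⋃ k, dyadicShell f k = Function.support f := by
  ext x
  simp only [Set.mem_iUnion, dyadicShell, Set.mem_ofPred_eq, Function.mem_support]
  constructor
  · rintro ⟨k, hk, -⟩
    exact abs_pos.1 (lt_trans (by positivity) hk)
  · intro hx
    exact exists_mem_Ioc_zpow (abs_pos.2 hx) one_lt_two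

lemma pairwise_disjoint_dyadicShell {X : Type*} (f : X → ℝ) :
    Pairwise (Function.onFun Disjoint (dyadicShell f)) := by
  have key : ∀ i j : ℤ, i < j → Disjoint (dyadicShell f i) (dyadicShell f j) := by
    intro i j hij
    refine Set.disjoint_left.2 fun x hi hj => ?_
    exact absurd (hi.2.trans (zpow_le_zpow_right₀ one_le_two (by omega : i + 1 ≤ j)))
      (not_le.2 hj.1)
  intro i j hij
  rcases hij.lt_or_gt with h | h
  · exact key i j h
  · exact (key j i h).symm

lemma measurableSet_dyadicShell {X : Type*} [MeasurableSpace X] {f : X → ℝ} (hf : Measurable f)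
    (k : ℤ) : MeasurableSet (dyadicShell f k) :=
  (measurableSet_lt measurable_const hf.abs).inter (measurableSet_le hf.abs measurable_const)

lemma hasSum_setIntegral_dyadicShell {X : Type*} [MeasurableSpace X] {μ : Measure X} {f h : X → ℝ}
    (hf : Measurable f) (hh : Integrable h μ) :
    HasSum (fun k => ∫ x in dyadicShell f k, h x ∂μ) (∫ x in Function.support f, h x ∂μ) := by
  rw [← iUnion_dyadicShell f]
  exact hasSum_integral_iUnion (measurableSet_dyadicShell hf) (pairwise_disjoint_dyadicShell f)
    hh.integrableOn

lemma superlevel_subset_support {X : Type*} (f : X → ℝ) {c : ℝ} (hc : 0 < c) :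
    {x | c ≤ |f x|} ⊆ Function.support f :=
  fun _ hx => abs_pos.1 (hc.trans_le hx)

lemma summable_dyadic_superlevel {X : Type*} [MeasurableSpace X] {μ : Measure X} {f : X → ℝ}
    {B q : ℝ} (hq : 0 < q) (hB : ∀ x, |f x| ≤ B) (hμ : μ (Function.support f) ≠ ∞) :
    Summable fun k : ℤ => ((2 : ℝ) ^ k) ^ q * (μ {x | (2 : ℝ) ^ k ≤ |f x|}).toReal := by
  refine Summable.of_nat_of_neg ?_ ?_
  · obtain ⟨N, hN⟩ := pow_unbounded_of_one_lt B (one_lt_two (α := ℝ))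
    refine summable_of_ne_finset_zero (s := Finset.range N) fun k hk => ?_
    have : {x | (2 : ℝ) ^ (k : ℤ) ≤ |f x|} = ∅ := by
      refine Set.eq_empty_of_forall_notMem fun x hx => ?_
      have h1 : (2 : ℝ) ^ N ≤ 2 ^ k :=
        pow_le_pow_right₀ one_le_two (by simpa using hk)
      have h2 : (2 : ℝ) ^ k ≤ |f x| := by simpa using hx
      linarith [hB x]
    rw [this]
    simp
  · refine Summable.of_nonneg_of_le (fun k => by positivity) (fun k => ?_)
      ((summable_geometric_of_lt_one (r := (2⁻¹ : ℝ) ^ q) (by positivity)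
        (Real.rpow_lt_one (by norm_num) (by norm_num) hq)).mul_right
          (μ (Function.support f)).toReal)
    have h1 : ((2 : ℝ) ^ (-(k : ℤ))) ^ q = ((2⁻¹ : ℝ) ^ q) ^ k := by
      rw [zpow_neg, zpow_natCast, ← inv_pow, ← Real.rpow_natCast, ← Real.rpow_mul (by norm_num),
        mul_comm, Real.rpow_mul (by norm_num), Real.rpow_natCast]
    rw [h1]
    gcongr
    exact superlevel_subset_support f (by positivity)

lemma integral_rpow_le_tsum_dyadic {X : Type*} [MeasurableSpace X] {μ : Measure X} {f : X → ℝ}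
    {B q : ℝ} (hq : 0 < q) (hf : Measurable f) (hB : ∀ x, |f x| ≤ B)
    (hμ : μ (Function.support f) ≠ ∞) (hi : Integrable (fun x => |f x| ^ q) μ) :
    ∫ x, |f x| ^ q ∂μ
      ≤ 2 ^ q * ∑' k : ℤ, ((2 : ℝ) ^ k) ^ q * (μ {x | (2 : ℝ) ^ k ≤ |f x|}).toReal := by
  have hs := hasSum_setIntegral_dyadicShell hf hi
  rw [setIntegral_eq_integral_of_forall_compl_eq_zero fun x hx => by
    simp [Function.notMem_support.1 hx, hq.ne']] at hs
  rw [← tsum_mul_left, ← hs.tsum_eq]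
  refine hs.summable.tsum_le_tsum (fun k => ?_)
    ((summable_dyadic_superlevel hq hB hμ).mul_left _)
  have hfin : μ {x | (2 : ℝ) ^ k ≤ |f x|} ≠ ∞ :=
    measure_ne_top_of_subset (superlevel_subset_support f (by positivity)) hμ
  have hsub : dyadicShell f k ⊆ {x | (2 : ℝ) ^ k ≤ |f x|} := fun x hx => hx.1.le
  have hfin' : μ (dyadicShell f k) ≠ ∞ := measure_ne_top_of_subset hsub hfin
  calc ∫ x in dyadicShell f k, |f x| ^ q ∂μ
      ≤ ∫ _ in dyadicShell f k, 2 ^ q * ((2 : ℝ) ^ k) ^ q ∂μ := by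
        refine setIntegral_mono_on hi.integrableOn (integrableOn_const hfin')
          (measurableSet_dyadicShell hf k) fun x hx => ?_
        rw [← Real.mul_rpow (by norm_num) (by positivity), mul_comm, ← zpow_add_one₀ two_ne_zero]
        exact Real.rpow_le_rpow (abs_nonneg _) hx.2 hq.le
    _ = 2 ^ q * (((2 : ℝ) ^ k) ^ q * (μ (dyadicShell f k)).toReal) := by
        rw [setIntegral_const, smul_eq_mul, Measure.real]
        ring
    _ ≤ _ := by gcongr

/-- The weak-type inequality applied to the smooth truncation of `f` between the levels `2 ^ k`
and `2 ^ (k + 1)`. -/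
lemma dyadic_superlevel_step {n m : ℕ} {α β p C r θ σ M : ℝ} (hα : 0 ≤ α) (hβ : 0 ≤ β)
    (hp : 0 < p) (hθ : θ ∈ Set.Ioc (0 : ℝ) 1) (hσ : 0 ≤ σ) (hC : 0 < C)
    (H : ∀ f : EuclideanSpace ℝ (Fin n) × EuclideanSpace ℝ (Fin m) → ℝ,
      ContDiff ℝ (⊤ : ℕ∞) f → HasCompactSupport f →
      ∀ lam : ℝ, 0 < lam →
        lam * (volume {ξ | lam ≤ |f ξ|}).toReal ^ (1 / r)
          ≤ C * ((∫ ξ, gradLNorm n m α β f ξ ^ p) ^ (1 / p)) ^ θ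
              * (eLpNorm f ⊤ volume).toReal ^ (1 - θ)
              * (volume (Function.support f)).toReal ^ σ)
    {ψ : ℝ → ℝ} (hψ : ContDiff ℝ (⊤ : ℕ∞) ψ) (hM : 0 < M) (hψ0 : ∀ t, |t| ≤ 1 → ψ t = 0)
    (hψ1 : ∀ t, 2 ≤ |t| → ψ t = 1) (hψle : ∀ t, |ψ t| ≤ 1) (hψM : ∀ t, |deriv ψ t| ≤ M)
    (hψz : ∀ t, ¬ (1 < |t| ∧ |t| ≤ 2) → deriv ψ t = 0) (hr : 0 < r)
    {f : EuclideanSpace ℝ (Fin n) × EuclideanSpace ℝ (Fin m) → ℝ} (hf : ContDiff ℝ (⊤ : ℕ∞) f)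
    (hfc : HasCompactSupport f) (k : ℤ) :
    (volume {ξ | (2 : ℝ) ^ (k + 1) ≤ |f ξ|}).toReal ^ (1 / r)
      ≤ C * M ^ θ * ((∫ ξ in dyadicShell f k, gradLNorm n m α β f ξ ^ p) ^ (1 / p)) ^ θ
        * ((2 : ℝ) ^ k) ^ (-θ) * (volume {ξ | (2 : ℝ) ^ k ≤ |f ξ|}).toReal ^ σ := by
  set c : ℝ := (2 : ℝ) ^ k with hc
  have hc0 : 0 < c := by positivity
  set φ : ℝ → ℝ := fun t => c * ψ (t / c) with hφ
  have hφsm : ContDiff ℝ (⊤ : ℕ∞) φ :=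
    contDiff_const.mul (hψ.comp (contDiff_id.div_const c))
  have hφd : ∀ t, deriv φ t = deriv ψ (t / c) := fun t => by
    have := (((hψ.differentiable (by simp)) (t / c)).hasDerivAt.comp t
      ((hasDerivAt_id t).div_const c)).const_mul c
    refine this.deriv.trans ?_
    field_simp
  have habs : ∀ t, |t / c| = |t| / c := fun t => by rw [abs_div, abs_of_pos hc0]
  have hsupp : (Function.support fun ξ => φ (f ξ)) ⊆ {ξ | c ≤ |f ξ|} := by
    intro ξ hξ
    by_contra hlt
    refine hξ ?_
    have : |f ξ / c| ≤ 1 := by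
      rw [habs, div_le_one hc0]
      exact (not_le.1 hlt).le
    simp [hφ, hψ0 _ this]
  have hfin : volume {ξ | c ≤ |f ξ|} ≠ ∞ := measure_ne_top_of_subset
    ((superlevel_subset_support f hc0).trans (subset_tsupport f)) hfc.measure_lt_top.ne
  have hFc : HasCompactSupport fun ξ => φ (f ξ) :=
    hfc.comp_left (g := φ) (by simp [hφ, hψ0])
  have hH := H (fun ξ => φ (f ξ)) (hφsm.comp hf) hFc c hc0
  have hlev : {ξ | (2 : ℝ) ^ (k + 1) ≤ |f ξ|} ⊆ {ξ | c ≤ |φ (f ξ)|} := by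
    intro ξ hξ
    have h2 : 2 ≤ |f ξ / c| := by
      rw [habs, le_div_iff₀ hc0, hc, mul_comm, ← zpow_add_one₀ two_ne_zero]
      exact hξ
    simp [hφ, hψ1 _ h2, abs_of_pos hc0]
  have hfin2 : volume {ξ | c ≤ |φ (f ξ)|} ≠ ∞ := measure_ne_top_of_subset
    ((superlevel_subset_support _ hc0).trans hsupp) hfin
  have hsup : (eLpNorm (fun ξ => φ (f ξ)) ⊤ volume).toReal ≤ c := by
    refine ENNReal.toReal_le_of_le_ofReal hc0.le ?_
    rw [eLpNorm_exponent_top]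
    refine eLpNormEssSup_le_of_ae_bound (Filter.Eventually.of_forall fun ξ => ?_)
    rw [Real.norm_eq_abs, hφ, abs_mul, abs_of_pos hc0]
    exact mul_le_of_le_one_right hc0.le (hψle _)
  set g := ∫ ξ in dyadicShell f k, gradLNorm n m α β f ξ ^ p with hg
  have hg0 : 0 ≤ g := integral_nonneg fun ξ => Real.rpow_nonneg (gradLNorm_nonneg ..) _
  have hint := integrable_gradLNorm_rpow hα hβ hp hf hfc
  have hgrad : (∫ ξ, gradLNorm n m α β (fun η => φ (f η)) ξ ^ p) ≤ M ^ p * g := by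
    rw [hg, ← integral_const_mul,
      ← integral_indicator (measurableSet_dyadicShell hf.continuous.measurable k)]
    refine integral_mono (integrable_gradLNorm_rpow hα hβ hp (hφsm.comp hf) hFc)
      ((hint.const_mul _).indicator (measurableSet_dyadicShell hf.continuous.measurable k))
      fun ξ => ?_
    simp only
    rw [gradLNorm_comp α β (hφsm.differentiable (by simp)) (hf.differentiable (by simp)), hφd]
    by_cases hξ : ξ ∈ dyadicShell f k
    · rw [Set.indicator_of_mem hξ, Real.mul_rpow (abs_nonneg _) (gradLNorm_nonneg ..)]
      have := Real.rpow_nonneg (gradLNorm_nonneg n m α β f ξ) p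
      gcongr
      exact hψM _
    · rw [Set.indicator_of_notMem hξ, hψz, abs_zero, zero_mul, Real.zero_rpow hp.ne']
      rintro ⟨h1, h2⟩
      rw [habs, one_lt_div hc0] at h1
      rw [habs, div_le_iff₀ hc0, mul_comm, hc, ← zpow_add_one₀ two_ne_zero] at h2
      exact hξ ⟨h1, h2⟩
  have hgrad' : (∫ ξ, gradLNorm n m α β (fun η => φ (f η)) ξ ^ p) ^ (1 / p)
      ≤ M * g ^ (1 / p) := by
    calc _ ≤ (M ^ p * g) ^ (1 / p) := Real.rpow_le_rpow
          (integral_nonneg fun ξ => Real.rpow_nonneg (gradLNorm_nonneg ..) _) hgrad (by positivity)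
      _ = M * g ^ (1 / p) := by
        rw [Real.mul_rpow (by positivity) hg0, ← Real.rpow_mul hM.le, mul_one_div_cancel hp.ne',
          Real.rpow_one]
  have hθ1 : 0 ≤ 1 - θ := by linarith [hθ.2]
  have hI0 : 0 ≤ ∫ ξ, gradLNorm n m α β (fun η => φ (f η)) ξ ^ p :=
    integral_nonneg fun ξ => Real.rpow_nonneg (gradLNorm_nonneg ..) _
  have hmain : c * (volume {ξ | (2 : ℝ) ^ (k + 1) ≤ |f ξ|}).toReal ^ (1 / r)
      ≤ C * (M * g ^ (1 / p)) ^ θ * c ^ (1 - θ) * (volume {ξ | c ≤ |f ξ|}).toReal ^ σ := by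
    have hθ0 := hθ.1.le
    refine (le_trans ?_ hH).trans ?_
    · gcongr
    · gcongr
  rw [Real.mul_rpow hM.le (by positivity), sub_eq_add_neg, Real.rpow_add hc0,
    Real.rpow_one] at hmain
  refine le_of_mul_le_mul_left (hmain.trans_eq ?_) hc0
  ring

/-- BCLS lemma: a weak-type Gagliardo–Nirenberg inequality implies the strong
Sobolev inequality `‖f‖_q ≤ C' ‖∇_L f‖_p`.  The parameters `r₀, s₀ ∈ (0,∞]`
are elements of `ℝ≥0∞`; with Lean's convention `x / 0 = 0`, the quantities
`1/r₀.toReal` and `(1−θ₀)/s₀.toReal` vanish when `r₀ = ∞`, resp. `s₀ = ∞`,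
matching the conventions of the natural-language statement. -/
theorem bcls_weak_to_strong (n m : ℕ) (hn : 1 ≤ n) (hm : 1 ≤ m)
    (α β : ℝ) (hα : α ∈ Set.Ioo (0 : ℝ) 1) (hβ : 0 ≤ β)
    (p : ℝ) (hp : 0 < p) (r₀ s₀ : ℝ≥0∞) (hr₀ : 0 < r₀) (hs₀ : 0 < s₀)
    (θ₀ : ℝ) (hθ₀ : θ₀ ∈ Set.Ioc (0 : ℝ) 1) (q : ℝ)
    (hq : 1 / r₀.toReal = θ₀ / q + (1 - θ₀) / s₀.toReal)
    (hpq : p ≤ q)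
    (C : ℝ) (hC : 0 < C)
    (H : ∀ f : EuclideanSpace ℝ (Fin n) × EuclideanSpace ℝ (Fin m) → ℝ,
      ContDiff ℝ (⊤ : ℕ∞) f → HasCompactSupport f →
      ∀ lam : ℝ, 0 < lam →
        lam * (volume {ξ | lam ≤ |f ξ|}).toReal ^ (1 / r₀.toReal)
          ≤ C * ((∫ ξ, gradLNorm n m α β f ξ ^ p) ^ (1 / p)) ^ θ₀
              * (eLpNorm f ⊤ volume).toReal ^ (1 - θ₀)
              * (volume (Function.support f)).toReal ^ ((1 - θ₀) / s₀.toReal)) :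
    ∃ C' : ℝ, 0 < C' ∧
      ∀ f : EuclideanSpace ℝ (Fin n) × EuclideanSpace ℝ (Fin m) → ℝ,
        ContDiff ℝ (⊤ : ℕ∞) f → HasCompactSupport f →
        (∫ ξ, |f ξ| ^ q) ^ (1 / q)
          ≤ C' * (∫ ξ, gradLNorm n m α β f ξ ^ p) ^ (1 / p) := by
  have hα0 := hα.1.le
  have hq0 : 0 < q := hp.trans_le hpq
  set σ := (1 - θ₀) / s₀.toReal with hσdef
  have hσ : 0 ≤ σ := div_nonneg (by linarith [hθ₀.2]) ENNReal.toReal_nonneg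
  have hr : 0 < r₀.toReal := by
    have : 0 < 1 / r₀.toReal := by
      rw [hq]
      have := div_pos hθ₀.1 hq0
      positivity
    exact one_div_pos.1 this
  set r := r₀.toReal with hrdef
  obtain ⟨ψ, M, hψ, hM, hψ0, hψ1, hψle, hψM, hψz⟩ := exists_smooth_truncation_profile
  set K := 2 ^ (q / r) * (C * M ^ θ₀) with hK
  have hK0 : 0 < K := by positivity
  set D := (K ^ r * 2 ^ (σ * r)) ^ (q / (θ₀ * r)) with hD
  have hθpos := hθ₀.1
  have hD0 : 0 < D := by positivity
  refine ⟨(2 ^ q * (2 * D)) ^ (1 / q), by positivity, fun f hf hfc => ?_⟩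
  obtain ⟨B, hB⟩ := hfc.exists_bound_of_continuous hf.continuous
  have hfin : volume (Function.support f) ≠ ∞ :=
    measure_ne_top_of_subset (subset_tsupport f) hfc.measure_lt_top.ne
  have hint := integrable_gradLNorm_rpow hα0 hβ hp hf hfc
  have hfq : Integrable fun ξ => |f ξ| ^ q :=
    (hf.continuous.abs.rpow_const fun _ => Or.inr hq0.le).integrable_of_hasCompactSupport
      (hfc.comp_left (g := fun t => |t| ^ q) (by simp [hq0.ne']))
  set a : ℤ → ℝ := fun k => ((2 : ℝ) ^ k) ^ q * (volume {ξ | (2 : ℝ) ^ k ≤ |f ξ|}).toReal with ha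
  set g : ℤ → ℝ := fun k => ∫ ξ in dyadicShell f k, gradLNorm n m α β f ξ ^ p with hg
  have hg0 : ∀ k, 0 ≤ g k :=
    fun k => integral_nonneg fun ξ => Real.rpow_nonneg (gradLNorm_nonneg ..) _
  have hrec : ∀ k, a (k + 1) ≤ a k / 2 + D * g k ^ (q / p) := by
    intro k
    have hstep := dyadic_superlevel_step hα0 hβ hp hθ₀ hσ hC H hψ hM hψ0 hψ1 hψle hψM hψz hr
      hf hfc k
    have hGq : g k ^ (q / p) = (g k ^ (1 / p)) ^ q := by
      rw [← Real.rpow_mul (hg0 k)]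
      ring_nf
    rw [hGq]
    refine le_half_add_of_rpow_le hq0 hr hθ₀.1 hσ hq hK0 (by positivity) (by positivity)
      (Real.rpow_nonneg (hg0 k) _) ?_
    set c : ℝ := (2 : ℝ) ^ k with hc
    have hc0 : 0 < c := by positivity
    have hexp : c ^ (q / r) * c ^ (-θ₀) = (c ^ q) ^ σ := by
      rw [← Real.rpow_add hc0, ← Real.rpow_mul hc0.le]
      congr 1
      rw [div_eq_mul_one_div, hq]
      field_simp
      ring
    have hpow : (((2 : ℝ) ^ (k + 1)) ^ q) ^ (1 / r) = 2 ^ (q / r) * c ^ (q / r) := by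
      rw [← Real.rpow_mul (by positivity), mul_one_div, zpow_add_one₀ two_ne_zero, mul_comm,
        Real.mul_rpow (by norm_num) hc0.le]
    calc (a (k + 1)) ^ (1 / r)
        = 2 ^ (q / r) * c ^ (q / r)
            * (volume {ξ | (2 : ℝ) ^ (k + 1) ≤ |f ξ|}).toReal ^ (1 / r) := by
          rw [ha, Real.mul_rpow (by positivity) ENNReal.toReal_nonneg, hpow]
      _ ≤ 2 ^ (q / r) * c ^ (q / r) * (C * M ^ θ₀ * (g k ^ (1 / p)) ^ θ₀ * c ^ (-θ₀)
            * (volume {ξ | c ≤ |f ξ|}).toReal ^ σ) :=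
          mul_le_mul_of_nonneg_left hstep (by positivity)
      _ = K * (g k ^ (1 / p)) ^ θ₀ * ((c ^ (q / r) * c ^ (-θ₀))
            * (volume {ξ | c ≤ |f ξ|}).toReal ^ σ) := by
          rw [hK]
          ring
      _ = K * (g k ^ (1 / p)) ^ θ₀ * (a k) ^ σ := by
          rw [hexp, ha, Real.mul_rpow (by positivity) ENNReal.toReal_nonneg]
  have hgsum := hasSum_setIntegral_dyadicShell hf.continuous.measurable hint
  have hsum := tsum_le_of_forall_le_half_add (summable_dyadic_superlevel hq0 hB hfin) hgsum hg0
    ((one_le_div hp).2 hpq) hD0.le hrec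
  have hI0 : 0 ≤ ∫ ξ, gradLNorm n m α β f ξ ^ p :=
    integral_nonneg fun ξ => Real.rpow_nonneg (gradLNorm_nonneg ..) _
  have hle : ∫ ξ in Function.support f, gradLNorm n m α β f ξ ^ p
      ≤ ∫ ξ, gradLNorm n m α β f ξ ^ p :=
    setIntegral_le_integral hint
      (Filter.Eventually.of_forall fun ξ => Real.rpow_nonneg (gradLNorm_nonneg ..) _)
  have hfinal : ∫ ξ, |f ξ| ^ q
      ≤ 2 ^ q * (2 * D) * (∫ ξ, gradLNorm n m α β f ξ ^ p) ^ (q / p) := by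
    calc ∫ ξ, |f ξ| ^ q ≤ 2 ^ q * ∑' k, a k :=
          integral_rpow_le_tsum_dyadic hq0 hf.continuous.measurable hB hfin hfq
      _ ≤ 2 ^ q * (2 * D * (∫ ξ, gradLNorm n m α β f ξ ^ p) ^ (q / p)) := by
          refine mul_le_mul_of_nonneg_left (hsum.trans ?_) (by positivity)
          have := hgsum.nonneg hg0
          gcongr
      _ = _ := by ring
  calc (∫ ξ, |f ξ| ^ q) ^ (1 / q)
      ≤ (2 ^ q * (2 * D) * (∫ ξ, gradLNorm n m α β f ξ ^ p) ^ (q / p)) ^ (1 / q) :=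
        Real.rpow_le_rpow (integral_nonneg fun ξ => by positivity) hfinal (by positivity)
    _ = (2 ^ q * (2 * D)) ^ (1 / q) * (∫ ξ, gradLNorm n m α β f ξ ^ p) ^ (1 / p) := by
        rw [Real.mul_rpow (by positivity) (by positivity), ← Real.rpow_mul hI0]
        congr 2
        field_simp
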